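/- Worst-case exponential family of incomparable labels. For every natural number m, the 2^m labels (c, 2^(m+1) − 1 − c) for 0 ≤ c ≤ 2^m − 1 are distinct, each is sorted (its first component does not exceed its second), and they are pairwise ⪯_=-incomparable; hence a single vertex can carry 2^m pairwise ⪯_=-incomparable labels. -/

import Mathlib

/-- Normal comparison on labels of natural-number trait costs. -/
def precN (li lj : ℕ × ℕ) : Prop := li.1 ≤ lj.1 ∧ li.2 ≤ lj.2

/-- Cross comparison on labels of natural-number trait costs. -/
def precX (li lj : ℕ × ℕ) : Prop := li.1 ≤ lj.2 ∧ li.2 ≤ lj.1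

/-- Combined comparison `⪯_=`: normal or cross. -/
def precEq (li lj : ℕ × ℕ) : Prop := precN li lj ∨ precX li lj

/-- Two labels are `⪯_=`-incomparable if neither compares to the other. -/
def Incomparable (li lj : ℕ × ℕ) : Prop := ¬ precEq li lj ∧ ¬ precEq lj li

/-- Worst-case exponential family: the `2^m` labels `(c, 2^(m+1) − 1 − c)`,
`0 ≤ c ≤ 2^m − 1`, are distinct, sorted, and pairwise `⪯_=`-incomparable. -/
theorem worstCaseFamily (m : ℕ) :
    (∀ c < 2 ^ m, ∀ c' < 2 ^ m,
        (c, 2 ^ (m + 1) - 1 - c) = (c', 2 ^ (m + 1) - 1 - c') → c = c') ∧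
    (∀ c < 2 ^ m, c ≤ 2 ^ (m + 1) - 1 - c) ∧
    (∀ c < 2 ^ m, ∀ c' < 2 ^ m, c ≠ c' →
        Incomparable (c, 2 ^ (m + 1) - 1 - c) (c', 2 ^ (m + 1) - 1 - c')) ∧
    Set.ncard {l : ℕ × ℕ | ∃ c < 2 ^ m, l = (c, 2 ^ (m + 1) - 1 - c)} = 2 ^ m := by
  have hpow : 2 ^ (m + 1) = 2 * 2 ^ m := pow_succ' 2 m
  refine ⟨fun c _ c' _ h => congrArg Prod.fst h, fun c hc => by omega, ?_, ?_⟩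
  · intro c hc c' hc' hne
    simp only [Incomparable, precEq, precN, precX]
    omega
  · have himage : {l : ℕ × ℕ | ∃ c < 2 ^ m, l = (c, 2 ^ (m + 1) - 1 - c)} =
        (fun c => (c, 2 ^ (m + 1) - 1 - c)) '' (Finset.range (2 ^ m) : Set ℕ) := by
      ext l
      simp [eq_comm]
    rw [himage, Set.ncard_image_of_injective _ fun c c' h => congrArg Prod.fst h,
      Set.ncard_coe_finset, Finset.card_range]
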